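/- For every natural number n ≥ 1 and all elements u, c of a commutative ring (e.g., all real numbers), Σ_{F ∈ F_n} u^{lead(F)} c^{tree(F)} = c·u · Π_{i=1}^{n−1} (i + (n−i)·u + c·u). -/

import Mathlib

/-!  Parking functions and the parking algorithm. -/

/-- Parking algorithm: cars `0, 1, ..., n-1` (in Lean's 0-based indexing of `Fin n`,
representing cars `1, ..., n`) arrive in order; car `i` drives to its favorite
(1-indexed) space `p i` and parks in the first space `s ≥ p i` not occupied by an
earlier car.  `PA p i` is the space where car `i` actually parks. -/
noncomputable def PA {n : ℕ} (p : Fin n → ℕ) (i : Fin n) : ℕ :=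
  sInf {s : ℕ | p i ≤ s ∧ ∀ j : Fin n, j < i → PA p j ≠ s}
termination_by i.val
decreasing_by exact ‹_ < _›

/-- `p` is a parking function of length `n`: every favorite space is in `{1, ..., n}`
and every car ends up parked in a space `≤ n`. -/
def IsParkingFunction {n : ℕ} (p : Fin n → ℕ) : Prop :=
  (∀ i, 1 ≤ p i ∧ p i ≤ n) ∧ ∀ i, PA p i ≤ n

/-- The set (type) `PF_n` of parking functions of length `n`. -/
def ParkingFunction (n : ℕ) : Type :=
  {p : Fin n → ℕ // IsParkingFunction p}

instance {n : ℕ} : Finite (ParkingFunction n) := by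
  apply Finite.of_injective
    (fun P : ParkingFunction n => fun i => (⟨P.1 i, Nat.lt_succ_of_le (P.2.1 i).2⟩ : Fin (n+1)))
  intro P Q h
  apply Subtype.ext; funext i
  simpa [Fin.mk.injEq] using congrFun h i

noncomputable instance {n : ℕ} : Fintype (ParkingFunction n) := Fintype.ofFinite _

/-- `jumpAt p c` is the number of jumps of car `c`, i.e. `q_c - p_c`. -/
noncomputable def jumpAt {n : ℕ} (p : Fin n → ℕ) (c : Fin n) : ℕ := PA p c - p c

/-- `jump p` is the total number of jumps. -/
noncomputable def jump {n : ℕ} (p : Fin n → ℕ) : ℕ := ∑ c, jumpAt p c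

/-- `luckyCount p k` is the number of cars `c` with `jump(p : c) = k`. -/
noncomputable def luckyCount {n : ℕ} (p : Fin n → ℕ) (k : ℕ) : ℕ :=
  Set.ncard {c : Fin n | jumpAt p c = k}

/-- `lucky p` is the number of lucky cars, i.e. cars with no jumps. -/
noncomputable def lucky {n : ℕ} (p : Fin n → ℕ) : ℕ :=
  Set.ncard {c : Fin n | jumpAt p c = 0}

/-- Car `c` is critical: immediately after car `c` is parked, there is no empty space
among the spaces strictly to the right of its space `q_c` within `{1, ..., n}`. -/
def IsCritical {n : ℕ} (p : Fin n → ℕ) (c : Fin n) : Prop :=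
  ∀ s : ℕ, PA p c < s → s ≤ n → ∃ j : Fin n, j ≤ c ∧ PA p j = s

/-- `critic p` is the number of critical cars. -/
noncomputable def critic {n : ℕ} (p : Fin n → ℕ) : ℕ :=
  Set.ncard {c : Fin n | IsCritical p c}

/-!  Rooted labeled forests, encoded by their parent function. -/

/-- A parent function `par : Fin n → Option (Fin n)` (where `par v = none` means that
`v` is a root) encodes a rooted labeled forest on `n` vertices iff it has no cycles. -/
def IsForest {n : ℕ} (par : Fin n → Option (Fin n)) : Prop :=
  ∀ v : Fin n, ¬ Relation.TransGen (fun a b => par a = some b) v v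

/-- The set (type) `F_n` of rooted labeled forests on `n` vertices. -/
def Forest (n : ℕ) : Type := {par : Fin n → Option (Fin n) // IsForest par}

instance {n : ℕ} : Finite (Forest n) := Subtype.finite
noncomputable instance {n : ℕ} : Fintype (Forest n) := Fintype.ofFinite _

/-- `x` is a descendant of `v`: `v` lies on the (unique) path from the root of `x`'s
component to `x`, i.e. the ancestor chain of `x` reaches `v`. -/
def Descendant {n : ℕ} (par : Fin n → Option (Fin n)) (v x : Fin n) : Prop :=
  Relation.ReflTransGen (fun a b => par a = some b) x v

/-- `forestInvAt F v = inv(F : v)`, the number of pairs `(v, x)` with `v > x` and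
`x` a descendant of `v`. -/
noncomputable def forestInvAt {n : ℕ} (F : Forest n) (v : Fin n) : ℕ :=
  Set.ncard {x : Fin n | x < v ∧ Descendant F.1 v x}

/-- `forestInv F = inv(F)`, the total number of inversions of `F`. -/
noncomputable def forestInv {n : ℕ} (F : Forest n) : ℕ := ∑ v, forestInvAt F v

/-- `forestLeadCount F k` is the number of vertices `v` with `inv(F : v) = k`. -/
noncomputable def forestLeadCount {n : ℕ} (F : Forest n) (k : ℕ) : ℕ :=
  Set.ncard {v : Fin n | forestInvAt F v = k}

/-- `forestLead F = lead(F)`, the number of leaders of `F`. -/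
noncomputable def forestLead {n : ℕ} (F : Forest n) : ℕ :=
  Set.ncard {v : Fin n | forestInvAt F v = 0}

/-- `forestTree F = tree(F)`, the number of trees (connected components) of `F`,
i.e. the number of roots. -/
noncomputable def forestTree {n : ℕ} (F : Forest n) : ℕ :=
  Set.ncard {v : Fin n | F.1 v = none}

/-!  Basic facts on parent functions. -/

namespace ParentFunction

variable {n : ℕ} {par : Fin n → Option (Fin n)} {S : Finset (Fin n)} {v w x y : Fin n}

/-- `w` is the smallest of its descendants. -/
def IsLeader (par : Fin n → Option (Fin n)) (w : Fin n) : Prop :=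
  ∀ x, Descendant par w x → w ≤ x

/-- There is a height function that decreases from each vertex to its parent. -/
def HasHeight (par : Fin n → Option (Fin n)) : Prop :=
  ∃ r : Fin n → ℕ, ∀ a b, par a = some b → r b < r a

/-- The parent function obtained by placing `y` between `v` and the parent of `v`. -/
def insertAbove (par : Fin n → Option (Fin n)) (v y : Fin n) : Fin n → Option (Fin n) :=
  Function.update (Function.update par v (some y)) y (par v)

lemma _root_.Descendant.height_le {r : Fin n → ℕ} (hr : ∀ a b, par a = some b → r b < r a)
    (h : Descendant par w x) : r w ≤ r x := by
  unfold Descendant at h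
  induction h with
  | refl => exact le_rfl
  | tail _ h₂ ih => exact (hr _ _ h₂).le.trans ih

lemma isForest_iff_hasHeight : IsForest par ↔ HasHeight par := by
  constructor
  · intro h
    refine ⟨fun a => Set.ncard {b | Relation.TransGen (fun a b => par a = some b) a b}, ?_⟩
    intro a b hab
    refine Set.ncard_lt_ncard ?_ (Set.toFinite _)
    refine ⟨fun x hx => Relation.TransGen.head hab hx, fun hsub => ?_⟩
    exact h b (hsub (Relation.TransGen.single hab))
  · rintro ⟨r, hr⟩ v hv
    have key : ∀ x, Relation.TransGen (fun a b => par a = some b) v x → r x < r v := by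
      intro x hx
      induction hx with
      | single h => exact hr _ _ h
      | tail _ h ih => exact (hr _ _ h).trans ih
    exact lt_irrefl _ (key v hv)

lemma _root_.Descendant.eq_of_leaf (hy : ∀ a, par a ≠ some y) (h : Descendant par y x) : x = y := by
  rcases Relation.ReflTransGen.cases_tail h with h | ⟨c, -, h⟩
  · exact h.symm
  · exact absurd h (hy c)

lemma isLeader_of_leaf (hy : ∀ a, par a ≠ some y) : IsLeader par y :=
  fun _ hx => (hx.eq_of_leaf hy).ge

lemma _root_.Descendant.mem (hS : ∀ x y, par x = some y → x ∈ S ∧ y ∈ S) (hw : w ∈ S)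
    (h : Descendant par w x) : x ∈ S := by
  rcases Relation.ReflTransGen.cases_head h with h | ⟨c, h, -⟩
  · exact h ▸ hw
  · exact (hS _ _ h).1

lemma exists_isLeader_descendant (par : Fin n → Option (Fin n)) (z : Fin n) :
    ∃ m, Descendant par z m ∧ IsLeader par m := by
  obtain ⟨m, hm, hmin⟩ := (wellFounded_lt (α := Fin n)).has_min {x | Descendant par z x}
    ⟨z, Relation.ReflTransGen.refl⟩
  exact ⟨m, hm, fun x hx => not_lt.1 (hmin x (Relation.ReflTransGen.trans hx hm))⟩

/-!  Adding a leaf. -/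

lemma _root_.Descendant.update (o : Option (Fin n)) (hy : par y = none) (h : Descendant par w x) :
    Descendant (Function.update par y o) w x := by
  refine Relation.ReflTransGen.mono (fun a b hab => ?_) _ _ h
  have : a ≠ y := by rintro rfl; simp [hy] at hab
  simpa [this] using hab

lemma _root_.Descendant.of_update {o : Option (Fin n)} (hy : ∀ a, par a ≠ some y) (hxy : x ≠ y)
    (h : Descendant (Function.update par y o) w x) : Descendant par w x := by
  unfold Descendant at h
  induction h using Relation.ReflTransGen.head_induction_on with
  | refl => exact Relation.ReflTransGen.refl
  | @head a c hac _ ih =>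
    have hac' : par a = some c := by simpa [hxy] using hac
    exact Relation.ReflTransGen.head hac' (ih fun h => hy a (h ▸ hac'))

lemma isLeader_update_iff {o : Option (Fin n)} (hy : par y = none) (hy' : ∀ a, par a ≠ some y)
    (hw : IsLeader par w → w < y) :
    IsLeader (Function.update par y o) w ↔ IsLeader par w := by
  constructor
  · exact fun h x hx => h x (hx.update o hy)
  · intro h x hx
    by_cases hxy : x = y
    · exact hxy ▸ (hw h).le
    · exact h x (hx.of_update hy' hxy)

lemma HasHeight.update {o : Option (Fin n)} (h : HasHeight par) (hy : ∀ a, par a ≠ some y)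
    (ho : o ≠ some y) : HasHeight (Function.update par y o) := by
  obtain ⟨r, hr⟩ := h
  refine ⟨Function.update r y (o.elim 0 r + 1), fun a b hab => ?_⟩
  by_cases ha : a = y
  · subst ha
    have hob : o = some b := by simpa using hab
    have hb : b ≠ a := by rintro rfl; exact ho hob
    simp [hb, hob]
  · have hpar : par a = some b := by simpa [ha] using hab
    have hb : b ≠ y := by rintro rfl; exact hy a hpar
    simpa [ha, hb] using hr a b hpar

/-!  Inserting a vertex into an edge. -/

lemma insertAbove_self (par : Fin n → Option (Fin n)) (v y : Fin n) :
    insertAbove par v y y = par v := by simp [insertAbove]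

lemma insertAbove_child (hvy : v ≠ y) : insertAbove par v y v = some y := by
  simp [insertAbove, hvy]

lemma insertAbove_of_ne (hv : x ≠ v) (hy : x ≠ y) : insertAbove par v y x = par x := by
  simp [insertAbove, hv, hy]

lemma eq_of_insertAbove_eq_some (hy' : ∀ a, par a ≠ some y)
    (h : insertAbove par v y x = some y) : x = v := by
  by_contra hxv
  by_cases hxy : x = y
  · subst hxy; rw [insertAbove_self] at h; exact hy' _ h
  · rw [insertAbove_of_ne hxv hxy] at h; exact hy' _ h

lemma _root_.Descendant.insertAbove (hvy : v ≠ y) (hy : par y = none) (h : Descendant par w x) :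
    Descendant (ParentFunction.insertAbove par v y) w x := by
  unfold Descendant at h
  induction h with
  | refl => exact Relation.ReflTransGen.refl
  | @tail b c _ hbc ih =>
    have hb : b ≠ y := by rintro rfl; simp [hy] at hbc
    by_cases hbv : b = v
    · subst hbv
      refine Relation.ReflTransGen.tail (Relation.ReflTransGen.tail ih (insertAbove_child hvy)) ?_
      rw [insertAbove_self, hbc]
    · refine Relation.ReflTransGen.tail ih ?_
      rw [insertAbove_of_ne hbv hb, hbc]

lemma _root_.Descendant.of_insertAbove (hvy : v ≠ y) (hy' : ∀ a, par a ≠ some y) (hw : w ≠ y)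
    (h : Descendant (ParentFunction.insertAbove par v y) w x) :
    Descendant par w (if x = y then v else x) := by
  unfold Descendant at h
  induction h using Relation.ReflTransGen.head_induction_on with
  | refl => rw [if_neg hw]; exact Relation.ReflTransGen.refl
  | @head a c hac _ ih =>
    by_cases ha : a = y
    · subst ha
      rw [insertAbove_self] at hac
      have hc : c ≠ a := by rintro rfl; exact hy' _ hac
      rw [if_neg hc] at ih
      rw [if_pos rfl]
      exact Relation.ReflTransGen.head hac ih
    · rw [if_neg ha]
      by_cases hav : a = v
      · subst hav
        rw [insertAbove_child hvy, Option.some_inj] at hac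
        rwa [if_pos hac.symm] at ih
      · rw [insertAbove_of_ne hav ha] at hac
        have hc : c ≠ y := by rintro rfl; exact hy' _ hac
        rw [if_neg hc] at ih
        exact Relation.ReflTransGen.head hac ih

lemma isLeader_insertAbove_iff (hvy : v < y) (hy : par y = none) (hy' : ∀ a, par a ≠ some y)
    (hw : w ≠ y) : IsLeader (insertAbove par v y) w ↔ IsLeader par w := by
  constructor
  · exact fun h x hx => h x (hx.insertAbove hvy.ne hy)
  · intro h x hx
    have := h _ (hx.of_insertAbove hvy.ne hy' hw)
    split_ifs at this with hxy
    · exact hxy ▸ this.trans hvy.le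
    · exact this

lemma not_isLeader_insertAbove (hvy : v < y) : ¬ IsLeader (insertAbove par v y) y :=
  fun h => (h v (Relation.ReflTransGen.single (insertAbove_child hvy.ne))).not_gt hvy

lemma HasHeight.insertAbove (h : HasHeight par) (hvy : v ≠ y) (hy' : ∀ a, par a ≠ some y) :
    HasHeight (insertAbove par v y) := by
  obtain ⟨r, hr⟩ := h
  refine ⟨Function.update (fun x => 2 * r x + 1) y (2 * r v), fun a b hab => ?_⟩
  by_cases ha : a = y
  · subst ha
    rw [insertAbove_self] at hab
    have hb : b ≠ a := by rintro rfl; exact hy' _ hab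
    have := hr _ _ hab
    simp only [Function.update_self, Function.update_of_ne hb]
    omega
  · by_cases hav : a = v
    · subst hav
      rw [insertAbove_child hvy, Option.some_inj] at hab
      subst hab
      simp [hvy]
    · rw [insertAbove_of_ne hav ha] at hab
      have hb : b ≠ y := by rintro rfl; exact hy' _ hab
      have := hr _ _ hab
      simp only [Function.update_of_ne ha, Function.update_of_ne hb]
      omega

/-!  Growing a forest one vertex at a time. -/

/-- A forest with vertex set `S` whose largest leader is `v`, all vertices outside `S` being
larger than `v`. -/
structure IsGrowthState (S : Finset (Fin n)) (par : Fin n → Option (Fin n)) (v : Fin n) :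
    Prop where
  closed : ∀ x y, par x = some y → x ∈ S ∧ y ∈ S
  hasHeight : HasHeight par
  mem : v ∈ S
  isLeader : IsLeader par v
  le : ∀ w ∈ S, IsLeader par w → w ≤ v
  lt : ∀ w ∉ S, v < w

namespace IsGrowthState

lemma eq_none (h : IsGrowthState S par v) (hy : y ∉ S) : par y = none := by
  cases hp : par y with
  | none => rfl
  | some z => exact absurd (h.closed _ _ hp).1 hy

lemma ne_some (h : IsGrowthState S par v) (hy : y ∉ S) (a : Fin n) : par a ≠ some y :=
  fun ha => hy (h.closed _ _ ha).2

lemma eq (h : IsGrowthState S par v) (hw : IsGrowthState S par w) : v = w :=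
  le_antisymm (hw.le v h.mem h.isLeader) (h.le w hw.mem hw.isLeader)

/-- The largest leader has no children. -/
lemma leaf (h : IsGrowthState S par v) (a : Fin n) : par a ≠ some v := by
  intro ha
  obtain ⟨m, hm, hml⟩ := exists_isLeader_descendant par a
  have hvm : Descendant par v m := Relation.ReflTransGen.tail hm ha
  have : v = m := le_antisymm (h.isLeader m hvm) (h.le m (hvm.mem h.closed h.mem) hml)
  subst this
  obtain ⟨r, hr⟩ := h.hasHeight
  exact (hm.height_le hr).not_gt (hr _ _ ha)

protected lemma insertAbove (h : IsGrowthState S par v) (hy : y ∉ S) :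
    IsGrowthState (insert y S) (insertAbove par v y) v := by
  have hvy := h.lt y hy
  have hlead : ∀ w, w ≠ y → (IsLeader (ParentFunction.insertAbove par v y) w ↔ IsLeader par w) :=
    fun w => isLeader_insertAbove_iff hvy (h.eq_none hy) (h.ne_some hy)
  refine ⟨fun a b hab => ?_, h.hasHeight.insertAbove hvy.ne (h.ne_some hy),
    Finset.mem_insert_of_mem h.mem, (hlead v hvy.ne).2 h.isLeader, fun w hw hwl => ?_,
    fun w hw => h.lt w fun hw' => hw (Finset.mem_insert_of_mem hw')⟩
  · by_cases ha : a = y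
    · subst ha
      rw [insertAbove_self] at hab
      exact ⟨Finset.mem_insert_self _ _, Finset.mem_insert_of_mem (h.closed _ _ hab).2⟩
    · by_cases hav : a = v
      · subst hav
        rw [insertAbove_child hvy.ne, Option.some_inj] at hab
        exact ⟨Finset.mem_insert_of_mem h.mem, hab ▸ Finset.mem_insert_self _ _⟩
      · rw [insertAbove_of_ne hav ha] at hab
        exact (h.closed _ _ hab).imp Finset.mem_insert_of_mem Finset.mem_insert_of_mem
  · have hwy : w ≠ y := by rintro rfl; exact not_isLeader_insertAbove hvy hwl
    exact h.le w (Finset.mem_of_mem_insert_of_ne hw hwy) ((hlead w hwy).1 hwl)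

lemma isLeader_update_iff (h : IsGrowthState S par v) (hy : y ∉ S) {o : Option (Fin n)}
    (hw : w ∈ S) : IsLeader (Function.update par y o) w ↔ IsLeader par w :=
  ParentFunction.isLeader_update_iff (h.eq_none hy) (h.ne_some hy)
    fun hl => (h.le w hw hl).trans_lt (h.lt y hy)

lemma update_ne_some (h : IsGrowthState S par v) (hy : y ∉ S) {o : Option (Fin n)}
    (ho : ∀ x, o = some x → x ∈ S) (a : Fin n) : Function.update par y o a ≠ some y := by
  by_cases ha : a = y
  · subst ha
    rw [Function.update_self]
    exact fun hoa => hy (ho _ hoa)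
  · rw [Function.update_of_ne ha]
    exact h.ne_some hy a

protected lemma update (h : IsGrowthState S par v) (hy : y ∉ S) (hmin : ∀ w ∉ S, y ≤ w)
    {o : Option (Fin n)} (ho : ∀ x, o = some x → x ∈ S) :
    IsGrowthState (insert y S) (Function.update par y o) y := by
  refine ⟨fun a b hab => ?_, h.hasHeight.update (h.ne_some hy) fun hoy => hy (ho _ hoy),
    Finset.mem_insert_self _ _, isLeader_of_leaf (h.update_ne_some hy ho), fun w hw hwl => ?_,
    fun w hw => ?_⟩
  · by_cases ha : a = y
    · subst ha
      rw [Function.update_self] at hab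
      exact ⟨Finset.mem_insert_self _ _, Finset.mem_insert_of_mem (ho _ hab)⟩
    · rw [Function.update_of_ne ha] at hab
      exact (h.closed _ _ hab).imp Finset.mem_insert_of_mem Finset.mem_insert_of_mem
  · rcases Finset.mem_insert.1 hw with rfl | hw
    · exact le_rfl
    · exact ((h.le w hw ((h.isLeader_update_iff hy hw).1 hwl)).trans_lt (h.lt y hy)).le
  · rw [Finset.mem_insert, not_or] at hw
    exact lt_of_le_of_ne (hmin w hw.2) (Ne.symm hw.1)

/-- Contracting the edge from the largest leader `v` to its parent `p`, when `v < p` and `v` is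
the only child of `p`. -/
lemma contract {p : Fin n} (h : IsGrowthState S par v) (hp : par v = some p) (hvp : v < p)
    (honly : ∀ a, par a = some p → a = v) :
    ∃ par₀, IsGrowthState (S.erase p) par₀ v ∧ insertAbove par₀ v p = par := by
  obtain ⟨r, hr⟩ := h.hasHeight
  have hpp : par p ≠ some p := fun hpp => lt_irrefl _ (hr _ _ hpp)
  set par₀ : Fin n → Option (Fin n) :=
    Function.update (Function.update par v (par p)) p none with hpar₀
  have hp₀ : par₀ p = none := by simp [hpar₀]
  have hv₀ : par₀ v = par p := by simp [hpar₀, hvp.ne]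
  have hne₀ : ∀ a, a ≠ v → a ≠ p → par₀ a = par a := fun a h₁ h₂ => by simp [hpar₀, h₁, h₂]
  have hp₀' : ∀ a, par₀ a ≠ some p := by
    intro a ha
    by_cases hap : a = p
    · subst hap; simp [hp₀] at ha
    · by_cases hav : a = v
      · subst hav; exact hpp (hv₀ ▸ ha)
      · exact hav (honly a (hne₀ a hav hap ▸ ha))
  have hins : insertAbove par₀ v p = par := by
    funext a
    by_cases hap : a = p
    · subst hap; rw [insertAbove_self, hv₀]
    · by_cases hav : a = v
      · subst hav; rw [insertAbove_child hvp.ne, hp]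
      · rw [insertAbove_of_ne hav hap, hne₀ a hav hap]
  have hlead : ∀ w, w ≠ p → (IsLeader par w ↔ IsLeader par₀ w) := fun w hw => by
    simpa only [hins] using isLeader_insertAbove_iff hvp hp₀ hp₀' hw
  refine ⟨par₀, ⟨fun a b hab => ?_, ⟨r, fun a b hab => ?_⟩, Finset.mem_erase.2 ⟨hvp.ne, h.mem⟩,
    (hlead v hvp.ne).1 h.isLeader, fun w hw hwl => ?_, fun w hw => ?_⟩, hins⟩
  · have hap : a ≠ p := by rintro rfl; simp [hp₀] at hab
    have hbp : b ≠ p := by rintro rfl; exact hp₀' _ hab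
    simp only [Finset.mem_erase, ne_eq, hap, hbp, not_false_eq_true, true_and]
    by_cases hav : a = v
    · subst hav
      exact ⟨h.mem, (h.closed _ _ (hv₀ ▸ hab)).2⟩
    · exact h.closed _ _ (hne₀ a hav hap ▸ hab)
  · have hap : a ≠ p := by rintro rfl; simp [hp₀] at hab
    by_cases hav : a = v
    · subst hav
      exact (hr _ _ (hv₀ ▸ hab)).trans (hr _ _ hp)
    · exact hr _ _ (hne₀ a hav hap ▸ hab)
  · rw [Finset.mem_erase] at hw
    exact h.le w hw.2 ((hlead w hw.1).2 hwl)
  · by_cases hwp : w = p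
    · exact hwp ▸ hvp
    · exact h.lt w fun hwS => hw (Finset.mem_erase.2 ⟨hwp, hwS⟩)

/-- Removing the largest leader when its edge cannot be contracted. -/
lemma remove (h : IsGrowthState S par v) (hS : (S.erase v).Nonempty)
    (hcon : ∀ p, par v = some p → v < p → ∃ a, par a = some p ∧ a ≠ v) :
    ∃ v₀, IsGrowthState (S.erase v) (Function.update par v none) v₀ := by
  classical
  obtain ⟨r, hr⟩ := h.hasHeight
  set par₀ := Function.update par v none with hpar₀
  have hedge : ∀ a b, par₀ a = some b → a ≠ v ∧ par a = some b := by
    intro a b hab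
    have hav : a ≠ v := by rintro rfl; simp [hpar₀] at hab
    exact ⟨hav, by simpa [hpar₀, hav] using hab⟩
  have hclosed : ∀ a b, par₀ a = some b → a ∈ S.erase v ∧ b ∈ S.erase v := by
    intro a b hab
    obtain ⟨hav, hab⟩ := hedge a b hab
    have hbv : b ≠ v := fun hbv => h.leaf a (hbv ▸ hab)
    exact ⟨Finset.mem_erase.2 ⟨hav, (h.closed _ _ hab).1⟩,
      Finset.mem_erase.2 ⟨hbv, (h.closed _ _ hab).2⟩⟩
  have hdesc : ∀ w x, x ≠ v → Descendant par w x → Descendant par₀ w x := by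
    intro w x hx hwx
    refine Descendant.of_update (y := v) (o := par v)
      (fun a ha => h.leaf a (hedge a v ha).2) hx ?_
    simpa [hpar₀] using hwx
  have hlt : ∀ w ∈ S.erase v, IsLeader par₀ w → w < v := by
    intro w hw hwl
    rw [Finset.mem_erase] at hw
    by_contra hvw
    have hvw : v < w := lt_of_le_of_ne (not_lt.1 hvw) (Ne.symm hw.1)
    have hvd : Descendant par w v := by
      by_contra hvd
      refine hvw.not_ge (h.le w hw.2 fun x hx => hwl x (hdesc w x ?_ hx))
      rintro rfl
      exact hvd hx
    rcases Relation.ReflTransGen.cases_head hvd with hwv | ⟨p, hp, hpw⟩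
    · exact hw.1 hwv.symm
    have hpv : p ≠ v := by rintro rfl; exact lt_irrefl _ (hr _ _ hp)
    obtain ⟨z, hz, hzv⟩ := hcon p hp (hvw.trans_le (hwl p (hdesc w p hpv hpw)))
    obtain ⟨m, hm, hml⟩ := exists_isLeader_descendant par z
    have hwm : Descendant par w m :=
      Relation.ReflTransGen.trans hm (Relation.ReflTransGen.head hz hpw)
    have hmv : m ≠ v := by
      rintro rfl
      rcases Relation.ReflTransGen.cases_head hm with hmz | ⟨q, hq, hqz⟩
      · exact hzv hmz.symm
      · obtain rfl : p = q := by simpa [hp] using hq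
        exact (Descendant.height_le hr hqz).not_gt (hr _ _ hz)
    exact hvw.not_ge ((hwl m (hdesc w m hmv hwm)).trans
      (h.le m (hwm.mem h.closed hw.2) hml))
  obtain ⟨z, hz⟩ := hS
  obtain ⟨m, hm, hml⟩ := exists_isLeader_descendant par₀ z
  have hne : ((S.erase v).filter (IsLeader par₀)).Nonempty :=
    ⟨m, Finset.mem_filter.2 ⟨hm.mem hclosed hz, hml⟩⟩
  have hmax := Finset.mem_filter.1 (Finset.max'_mem _ hne)
  refine ⟨_, hclosed, ⟨r, fun a b hab => hr _ _ (hedge a b hab).2⟩, hmax.1, hmax.2,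
    fun w hw hwl => Finset.le_max' _ _ (Finset.mem_filter.2 ⟨hw, hwl⟩), fun w hw => ?_⟩
  refine (hlt _ hmax.1 hmax.2).trans_le ?_
  by_cases hwv : w = v
  · exact hwv.ge
  · exact (h.lt w fun hwS => hw (Finset.mem_erase.2 ⟨hwv, hwS⟩)).le

end IsGrowthState

/-!  Weights. -/

section Weight

variable {R : Type*} [CommRing R] (u c : R)

open Classical in
/-- The weight `u ^ lead * c ^ tree` of a forest with vertex set `S`. -/
noncomputable def weight (S : Finset (Fin n)) (par : Fin n → Option (Fin n)) : R :=
  (∏ x ∈ S, if IsLeader par x then u else 1) * ∏ x ∈ S, (if par x = none then c else 1)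

lemma IsGrowthState.weight_insertAbove (h : IsGrowthState S par v) (hy : y ∉ S) :
    weight u c (insert y S) (ParentFunction.insertAbove par v y) = weight u c S par := by
  classical
  have hvy := h.lt y hy
  have hne : ∀ x ∈ S, x ≠ y := fun x hx hxy => hy (hxy ▸ hx)
  unfold weight
  congr 1
  · rw [Finset.prod_insert hy, if_neg (not_isLeader_insertAbove hvy), one_mul]
    exact Finset.prod_congr rfl fun x hx => if_congr
      (isLeader_insertAbove_iff hvy (h.eq_none hy) (h.ne_some hy) (hne x hx)) rfl rfl
  · rw [Finset.prod_insert hy, insertAbove_self, ← Finset.mul_prod_erase S _ h.mem,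
      ← Finset.mul_prod_erase S _ h.mem, insertAbove_child hvy.ne, if_neg (Option.some_ne_none y),
      one_mul]
    congr 1
    refine Finset.prod_congr rfl fun x hx => ?_
    rw [Finset.mem_erase] at hx
    rw [insertAbove_of_ne hx.1 (hne x hx.2)]

lemma IsGrowthState.weight_update (h : IsGrowthState S par v) (hy : y ∉ S) {o : Option (Fin n)}
    (ho : ∀ x, o = some x → x ∈ S) :
    weight u c (insert y S) (Function.update par y o)
      = weight u c S par * (u * if o = none then c else 1) := by
  classical
  have hroot : ∀ x ∈ S, (if Function.update par y o x = none then c else 1)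
      = if par x = none then c else 1 := fun x hx => by
    rw [Function.update_of_ne (ne_of_mem_of_not_mem hx hy)]
  unfold weight
  rw [Finset.prod_insert hy, Finset.prod_insert hy, Function.update_self,
    if_pos (isLeader_of_leaf (h.update_ne_some hy ho)),
    Finset.prod_congr rfl fun x hx => if_congr (h.isLeader_update_iff (o := o) hy hx) rfl rfl,
    Finset.prod_congr rfl hroot]
  ring

open Classical in
/-- The growth states with `j` vertices. -/
noncomputable def growthStates (n j : ℕ) :
    Finset (Finset (Fin n) × (Fin n → Option (Fin n)) × Fin n) :=
  Finset.univ.filter fun s => IsGrowthState s.1 s.2.1 s.2.2 ∧ s.1.card = j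

lemma mem_growthStates {j : ℕ} {s : Finset (Fin n) × (Fin n → Option (Fin n)) × Fin n} :
    s ∈ growthStates n j ↔ IsGrowthState s.1 s.2.1 s.2.2 ∧ s.1.card = j := by
  simp [growthStates]

/-- The smallest vertex outside `S`, or `v` if there is none. -/
def nextVertex (S : Finset (Fin n)) (v : Fin n) : Fin n :=
  if h : Sᶜ.Nonempty then Sᶜ.min' h else v

lemma nextVertex_notMem (hS : S.card < n) : nextVertex S v ∉ S := by
  have h : Sᶜ.Nonempty := Finset.card_pos.1 (by rw [Finset.card_compl, Fintype.card_fin]; omega)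
  rw [nextVertex, dif_pos h]
  exact Finset.mem_compl.1 (Finset.min'_mem _ h)

lemma nextVertex_le (hw : w ∉ S) : nextVertex S v ≤ w := by
  have hw := Finset.mem_compl.2 hw
  rw [nextVertex, dif_pos ⟨w, hw⟩]
  exact Finset.min'_le _ _ hw

/-- One growth step: insert a new vertex above the current one, or start a new leaf at the
smallest unused vertex. -/
def grow (s : Finset (Fin n) × (Fin n → Option (Fin n)) × Fin n) :
    Fin n ⊕ Option (Fin n) → Finset (Fin n) × (Fin n → Option (Fin n)) × Fin n
  | .inl y => (insert y s.1, insertAbove s.2.1 s.2.2 y, s.2.2)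
  | .inr o => (insert (nextVertex s.1 s.2.2) s.1,
      Function.update s.2.1 (nextVertex s.1 s.2.2) o, nextVertex s.1 s.2.2)

/-- The possible growth steps from a forest with vertex set `S`. -/
def growthChoices (S : Finset (Fin n)) : Finset (Fin n ⊕ Option (Fin n)) :=
  Sᶜ.disjSum (Finset.insertNone S)

lemma grow_mem {j : ℕ} (hj : j < n) {s : Finset (Fin n) × (Fin n → Option (Fin n)) × Fin n}
    (hs : s ∈ growthStates n j) {t : Fin n ⊕ Option (Fin n)} (ht : t ∈ growthChoices s.1) :
    grow s t ∈ growthStates n (j + 1) := by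
  rw [mem_growthStates] at hs ⊢
  obtain ⟨h, hcard⟩ := hs
  rcases t with y | o
  · have hy : y ∉ s.1 := by simpa [growthChoices] using ht
    exact ⟨h.insertAbove hy, by simp [grow, hy, hcard]⟩
  · have ho : ∀ x, o = some x → x ∈ s.1 := by simpa [growthChoices, Finset.mem_insertNone] using ht
    have hy : nextVertex s.1 s.2.2 ∉ s.1 := nextVertex_notMem (hcard ▸ hj)
    exact ⟨h.update hy (fun w => nextVertex_le) ho, by simp [grow, hy, hcard]⟩

lemma insertAbove_ne_update {S' : Finset (Fin n)} {par' : Fin n → Option (Fin n)} {v' y' : Fin n}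
    {o : Option (Fin n)} (h : IsGrowthState S par v) (hy : y ∉ S)
    (h' : IsGrowthState S' par' v') (hy' : y' ∉ S') (hvy' : v = y')
    (ho : ∀ x, o = some x → x ∈ S') :
    insertAbove par v y ≠ Function.update par' y' o := by
  intro heq
  subst hvy'
  have hvy := h.lt y hy
  have ho' : o = some y := by
    have := congrFun heq v
    rwa [insertAbove_child hvy.ne, Function.update_self, eq_comm] at this
  have hleaf : ∀ a, par' a ≠ some y := by
    intro a ha
    have hav : a ≠ v := by rintro rfl; simp [h'.eq_none hy'] at ha
    refine hav (eq_of_insertAbove_eq_some (h.ne_some hy) ?_)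
    rw [heq, Function.update_of_ne hav, ha]
  exact (((h'.le y (ho y ho') (isLeader_of_leaf hleaf)).trans_lt (h'.lt v hy')).trans hvy).false

lemma grow_injective {j : ℕ} (hj : j < n)
    {s s' : Finset (Fin n) × (Fin n → Option (Fin n)) × Fin n}
    (hs : s ∈ growthStates n j) (hs' : s' ∈ growthStates n j) {t t' : Fin n ⊕ Option (Fin n)}
    (ht : t ∈ growthChoices s.1) (ht' : t' ∈ growthChoices s'.1) (heq : grow s t = grow s' t') :
    s = s' ∧ t = t' := by
  rw [mem_growthStates] at hs hs'
  obtain ⟨h, hcard⟩ := hs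
  obtain ⟨h', hcard'⟩ := hs'
  have hz : nextVertex s.1 s.2.2 ∉ s.1 := nextVertex_notMem (hcard ▸ hj)
  have hz' : nextVertex s'.1 s'.2.2 ∉ s'.1 := nextVertex_notMem (hcard' ▸ hj)
  obtain ⟨S, par, v⟩ := s
  obtain ⟨S', par', v'⟩ := s'
  rcases t with y | o <;> rcases t' with y' | o' <;>
    simp only [growthChoices, Finset.inl_mem_disjSum, Finset.inr_mem_disjSum, Finset.mem_compl,
      Finset.mem_insertNone, Option.mem_def, grow, Prod.mk.injEq] at ht ht' heq h h' hz hz'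
  · obtain ⟨hS, hpar, rfl⟩ := heq
    have hvy := h.lt y ht
    have hvy' := h'.lt y' ht'
    obtain rfl : y = y' := by
      have := congrFun hpar v
      rwa [insertAbove_child hvy.ne, insertAbove_child hvy'.ne, Option.some_inj] at this
    have hSS : S = S' := by
      rw [← Finset.erase_insert ht, hS, Finset.erase_insert ht']
    have hpp : par = par' := by
      funext a
      by_cases hay : a = y
      · rw [hay, h.eq_none ht, h'.eq_none ht']
      · by_cases hav : a = v
        · have := congrFun hpar y
          rwa [insertAbove_self, insertAbove_self, ← hav] at this
        · have := congrFun hpar a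
          rwa [insertAbove_of_ne hav hay, insertAbove_of_ne hav hay] at this
    exact ⟨by rw [hSS, hpp], rfl⟩
  · exact absurd heq.2.1 (insertAbove_ne_update h ht h' hz' heq.2.2 ht')
  · exact absurd heq.2.1.symm (insertAbove_ne_update h' ht' h hz heq.2.2.symm ht)
  · obtain ⟨hS, hpar, hzz⟩ := heq
    rw [← hzz] at hS hpar hz'
    obtain rfl : S = S' := by
      rw [← Finset.erase_insert hz, hS, Finset.erase_insert hz']
    obtain rfl : o = o' := by simpa using congrFun hpar (nextVertex S v)
    obtain rfl : par = par' := by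
      funext a
      by_cases haz : a = nextVertex S v
      · rw [haz, h.eq_none hz, h'.eq_none hz']
      · simpa [haz] using congrFun hpar a
    exact ⟨by rw [h.eq h'], rfl⟩

lemma exists_grow_eq {j : ℕ} (hj : 1 ≤ j)
    {s : Finset (Fin n) × (Fin n → Option (Fin n)) × Fin n} (hs : s ∈ growthStates n (j + 1)) :
    ∃ s₀ ∈ growthStates n j, ∃ t ∈ growthChoices s₀.1, grow s₀ t = s := by
  rw [mem_growthStates] at hs
  obtain ⟨S, par, v⟩ := s
  obtain ⟨h, hcard⟩ := hs
  simp only at h hcard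
  by_cases hcon : ∃ p, par v = some p ∧ v < p ∧ ∀ a, par a = some p → a = v
  · obtain ⟨p, hp, hvp, honly⟩ := hcon
    obtain ⟨par₀, h₀, hins⟩ := h.contract hp hvp honly
    have hpS := (h.closed _ _ hp).2
    refine ⟨(S.erase p, par₀, v), mem_growthStates.2 ⟨h₀, ?_⟩, .inl p, ?_, ?_⟩
    · simp [Finset.card_erase_of_mem hpS, hcard]
    · simp [growthChoices]
    · simp [grow, hins, Finset.insert_erase hpS]
  · push Not at hcon
    have hcard' : (S.erase v).card = j := by simp [Finset.card_erase_of_mem h.mem, hcard]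
    obtain ⟨v₀, h₀⟩ := h.remove (Finset.card_pos.1 (hcard' ▸ hj)) hcon
    have hnext : nextVertex (S.erase v) v₀ = v := by
      refine le_antisymm (nextVertex_le (Finset.notMem_erase v S)) ?_
      have hlt : (S.erase v).card < n := by
        have := S.card_le_univ
        rw [Fintype.card_fin] at this
        omega
      have hz := nextVertex_notMem (v := v₀) hlt
      by_contra hlt'
      exact (h.lt _ fun hzS => hz (Finset.mem_erase.2 ⟨(not_le.1 hlt').ne, hzS⟩)).not_gt
        (not_le.1 hlt')
    refine ⟨(S.erase v, Function.update par v none, v₀), mem_growthStates.2 ⟨h₀, hcard'⟩,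
      .inr (par v), ?_, ?_⟩
    · simp only [growthChoices, Finset.inr_mem_disjSum, Finset.mem_insertNone, Option.mem_def]
      intro x hx
      exact Finset.mem_erase.2 ⟨fun hxv => h.leaf v (hxv ▸ hx), (h.closed _ _ hx).2⟩
    · simp [grow, hnext, Finset.insert_erase h.mem]

lemma sum_weight_grow {j : ℕ} (hj : j < n)
    {s : Finset (Fin n) × (Fin n → Option (Fin n)) × Fin n} (hs : s ∈ growthStates n j) :
    ∑ t ∈ growthChoices s.1, weight u c (grow s t).1 (grow s t).2.1
      = weight u c s.1 s.2.1 * (((n - j : ℕ) : R) + j * u + c * u) := by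
  rw [mem_growthStates] at hs
  obtain ⟨h, hcard⟩ := hs
  simp only [growthChoices, Finset.sum_disjSum, grow]
  rw [Finset.sum_congr rfl fun y hy => h.weight_insertAbove u c (Finset.mem_compl.1 hy),
    Finset.sum_congr rfl fun o ho => h.weight_update u c (o := o)
      (nextVertex_notMem (hcard ▸ hj)) (Finset.mem_insertNone.1 ho),
    Finset.sum_const, Finset.card_compl, Fintype.card_fin, hcard, ← Finset.mul_sum,
    Finset.sum_insertNone]
  simp only [if_true, Option.some_ne_none, if_false, mul_one, Finset.sum_const, hcard,
    nsmul_eq_mul]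
  ring

lemma sum_growthStates_succ {j : ℕ} (hj : 1 ≤ j) (hjn : j < n) :
    ∑ s ∈ growthStates n (j + 1), weight u c s.1 s.2.1
      = (∑ s ∈ growthStates n j, weight u c s.1 s.2.1)
        * (((n - j : ℕ) : R) + j * u + c * u) := by
  rw [Finset.sum_mul, ← Finset.sum_congr rfl fun s hs => sum_weight_grow u c hjn hs,
    Finset.sum_sigma']
  symm
  refine Finset.sum_bij (fun p _ => grow p.1 p.2) ?_ ?_ ?_ fun _ _ => rfl
  · rintro ⟨s, t⟩ hst
    rw [Finset.mem_sigma] at hst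
    exact grow_mem hjn hst.1 hst.2
  · rintro ⟨s, t⟩ hst ⟨s', t'⟩ hst' heq
    rw [Finset.mem_sigma] at hst hst'
    obtain ⟨rfl, rfl⟩ := grow_injective hjn hst.1 hst'.1 hst.2 hst'.2 heq
    rfl
  · intro s hs
    obtain ⟨s₀, hs₀, t, ht, heq⟩ := exists_grow_eq hj hs
    exact ⟨⟨s₀, t⟩, Finset.mem_sigma.2 ⟨hs₀, ht⟩, heq⟩

lemma isLeader_of_forall_eq_none (hpar : ∀ a, par a = none) (v : Fin n) : IsLeader par v :=
  isLeader_of_leaf fun a => by simp [hpar a]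

lemma growthStates_one (m : ℕ) : growthStates (m + 1) 1 = {({0}, fun _ => none, 0)} := by
  ext ⟨S, par, v⟩
  rw [mem_growthStates, Finset.mem_singleton]
  constructor
  · rintro ⟨h, hcard⟩
    obtain ⟨x, hx⟩ := Finset.card_eq_one.1 hcard
    simp only at h hx
    subst hx
    obtain rfl : v = x := Finset.mem_singleton.1 h.mem
    have hv : v = 0 := by
      by_contra hv
      exact (h.lt 0 fun h0 => hv (Finset.mem_singleton.1 h0).symm).not_ge (Fin.zero_le v)
    subst hv
    obtain ⟨r, hr⟩ := h.hasHeight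
    refine Prod.ext rfl (Prod.ext (funext fun a => ?_) rfl)
    cases hp : par a with
    | none => exact hp
    | some b =>
      have hab := h.closed _ _ hp
      simp only [Finset.mem_singleton] at hab
      have := hr _ _ hp
      rw [hab.1, hab.2] at this
      exact absurd this (lt_irrefl _)
  · intro heq
    simp only [Prod.mk.injEq] at heq
    obtain ⟨rfl, rfl, rfl⟩ := heq
    refine ⟨⟨by simp, ⟨fun _ => 0, by simp⟩, Finset.mem_singleton_self _,
      isLeader_of_forall_eq_none (fun _ => rfl) _, fun w hw _ => (Finset.mem_singleton.1 hw).le,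
      fun w hw => ?_⟩, Finset.card_singleton _⟩
    exact Fin.pos_iff_ne_zero.2 fun h0 => hw (Finset.mem_singleton.2 h0)

lemma sum_growthStates {m j : ℕ} (hj : j ≤ m) :
    ∑ s ∈ growthStates (m + 1) (j + 1), weight u c s.1 s.2.1
      = c * u * ∏ i ∈ Finset.range j,
        (((m - i : ℕ) : R) + ((i + 1 : ℕ) : R) * u + c * u) := by
  induction j with
  | zero =>
    rw [growthStates_one, Finset.sum_singleton]
    simp [weight, isLeader_of_forall_eq_none, mul_comm]
  | succ j ih =>
    rw [sum_growthStates_succ u c (by omega) (by omega), ih (by omega), Finset.prod_range_succ,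
      mul_assoc, Nat.add_sub_add_right]

/-!  Comparison with forests. -/

lemma forestInvAt_eq_zero_iff (F : Forest n) (v : Fin n) :
    forestInvAt F v = 0 ↔ IsLeader F.1 v := by
  rw [forestInvAt, Set.ncard_eq_zero (Set.toFinite _), Set.eq_empty_iff_forall_notMem]
  exact forall_congr' fun x =>
    ⟨fun h hx => not_lt.1 fun hlt => h ⟨hlt, hx⟩, fun h hx => hx.1.not_ge (h hx.2)⟩

lemma weight_univ (F : Forest n) :
    weight u c Finset.univ F.1 = u ^ forestLead F * c ^ forestTree F := by
  classical
  have hcard : ∀ (p : Fin n → Prop) [DecidablePred p] (a : R),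
      ∏ x, (if p x then a else 1) = a ^ Set.ncard {x | p x} := by
    intro p _ a
    rw [Finset.prod_ite, Finset.prod_const, Finset.prod_const_one, mul_one,
      ← Set.ncard_coe_finset]
    simp
  simp only [weight, hcard, forestLead, forestTree, forestInvAt_eq_zero_iff]

lemma exists_isGrowthState_univ (hn : 1 ≤ n) (F : Forest n) :
    ∃ v, IsGrowthState Finset.univ F.1 v := by
  classical
  obtain ⟨m, -, hm⟩ := exists_isLeader_descendant F.1 ⟨0, hn⟩
  have hne : (Finset.univ.filter (IsLeader F.1)).Nonempty := ⟨m, by simpa using hm⟩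
  refine ⟨_, fun _ _ _ => by simp, isForest_iff_hasHeight.1 F.2, Finset.mem_univ _,
    (Finset.mem_filter.1 (Finset.max'_mem _ hne)).2, fun w _ hwl => Finset.le_max' _ _ ?_,
    fun w hw => absurd (Finset.mem_univ w) hw⟩
  simpa using hwl

lemma sum_forest_eq_sum_growthStates (hn : 1 ≤ n) :
    ∑ F : Forest n, u ^ forestLead F * c ^ forestTree F
      = ∑ s ∈ growthStates n n, weight u c s.1 s.2.1 := by
  have huniv : ∀ s ∈ growthStates n n, s.1 = Finset.univ := fun s hs =>
    (Finset.card_eq_iff_eq_univ _).1 (by rw [(mem_growthStates.1 hs).2, Fintype.card_fin])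
  symm
  refine Finset.sum_bij (fun s hs =>
    (⟨s.2.1, isForest_iff_hasHeight.2 (mem_growthStates.1 hs).1.hasHeight⟩ : Forest n))
    (fun _ _ => Finset.mem_univ _) ?_ ?_ ?_
  · rintro ⟨S, par, v⟩ hs ⟨S', par', v'⟩ hs' heq
    obtain rfl : S = Finset.univ := huniv _ hs
    obtain rfl : S' = Finset.univ := huniv _ hs'
    obtain rfl : par = par' := congrArg Subtype.val heq
    obtain rfl : v = v' := (mem_growthStates.1 hs).1.eq (mem_growthStates.1 hs').1
    rfl
  · intro F _
    obtain ⟨v, hv⟩ := exists_isGrowthState_univ hn F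
    exact ⟨(Finset.univ, F.1, v), mem_growthStates.2 ⟨hv, by simp⟩, rfl⟩
  · intro s hs
    exact (congrArg (weight u c · s.2.1) (huniv s hs)).trans (weight_univ u c
      (⟨s.2.1, isForest_iff_hasHeight.2 (mem_growthStates.1 hs).1.hasHeight⟩ : Forest n))

end Weight

end ParentFunction

/-- Seo–Shin formula with the number of trees:
`Σ_{F ∈ F_n} u^{lead F} c^{tree F} = c·u · Π_{i=1}^{n-1} (i + (n-i)·u + c·u)`. -/
theorem sum_lead_tree_eq_prod (n : ℕ) (hn : 1 ≤ n) (R : Type*) [CommRing R] (u c : R) :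
    ∑ F : Forest n, u ^ forestLead F * c ^ forestTree F
      = c * u * ∏ i ∈ Finset.Icc 1 (n - 1), ((i : R) + ((n - i : ℕ) : R) * u + c * u) := by
  obtain ⟨m, rfl⟩ : ∃ m, n = m + 1 := ⟨n - 1, by omega⟩
  rw [ParentFunction.sum_forest_eq_sum_growthStates u c hn,
    ParentFunction.sum_growthStates u c le_rfl, Nat.add_sub_cancel]
  congr 1
  refine Finset.prod_bij' (fun i _ => m - i) (fun i _ => m - i) ?_ ?_ ?_ ?_ ?_ <;>
    intro i hi <;> simp only [Finset.mem_range, Finset.mem_Icc] at hi ⊢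
  · omega
  · omega
  · omega
  · omega
  · rw [show m + 1 - (m - i) = i + 1 by omega]
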